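/- The Kerov polynomial identity Σ₃ = R₄ + R₂ holds: for every Young diagram λ, the normalized character Σ₃^λ = n(n−1)(n−2)·χ^λ((1,2,3))/dim(λ) (where n = |λ| and χ^λ is the character of the irreducible representation of S(n) indexed by λ, extended by fixed points) equals R₄^λ + R₂^λ, where R_k^λ are the free cumulants of the Kerov transition measure of λ. -/

import Mathlib

open Finset MvPolynomial Equiv
open scoped Classical

noncomputable section

/-- The fundamental functional of shape `S_n^λ = (n−1)·∬_{□∈λ} (contents □)^{n−2} d□`
(French convention, each box a unit square), evaluated in closed form: for a box in row
`i` and column `j` (content `c = j − i`), the integral of `(x−y)^{n−2}` over the box is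
`((c+1)^n − 2c^n + (c−1)^n)/((n−1)n)`. -/
def Sfun (lam : YoungDiagram) (n : ℕ) : ℚ :=
  (1 / (n : ℚ)) * ∑ box ∈ lam.cells,
    (((box.2 : ℚ) - (box.1 : ℚ) + 1) ^ n - 2 * ((box.2 : ℚ) - (box.1 : ℚ)) ^ n +
      ((box.2 : ℚ) - (box.1 : ℚ) - 1) ^ n)

/-- The free cumulants of (the Kerov transition measure of) a Young diagram, expressed
through the functionals `S_k` by the universal formula
`R_n = ∑_{l≥1} (1/l!) (−n+1)^{l−1} ∑_{k₁+⋯+k_l=n, kᵢ≥1} S_{k₁}⋯S_{k_l}`. -/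
def Rfun (lam : YoungDiagram) (n : ℕ) : ℚ :=
  ∑ l ∈ Finset.Icc 1 n,
    ((1 - (n : ℚ)) ^ (l - 1) / (Nat.factorial l)) *
      ∑ c ∈ (Finset.Nat.antidiagonalTuple l n).filter (fun c => ∀ i, 1 ≤ c i),
        ∏ i, Sfun lam (c i)

/-- The exponent vector `λ + δ` (with `δ = (n−1, n−2, …, 0)`) of the dominant monomial. -/
def domExp (n : ℕ) (lam : YoungDiagram) : (Fin n) →₀ ℕ :=
  Finsupp.equivFunOnFinite.symm fun i => lam.rowLen i + (n - 1 - (i : ℕ))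

/-- The Vandermonde alternant `a_δ = ∑_σ sgn(σ) ∏_i x_i^{δ_{σ(i)}}` in `n` variables. -/
def vandermonde (n : ℕ) : MvPolynomial (Fin n) ℚ :=
  ∑ σ : Perm (Fin n), (Perm.sign σ : ℤ) • ∏ i, X i ^ (n - 1 - ((σ i : ℕ)))

/-- The power sum `p_k = ∑ x_i^k` in `n` variables. -/
def powerSum (n k : ℕ) : MvPolynomial (Fin n) ℚ :=
  ∑ i : Fin n, X i ^ k

/-- The value `χ^λ((1,2,3))·(something)`: the irreducible character of `S(n)` (for
`n = |λ|`) at a permutation of cycle type `(3,1^{n−3})`, defined through the Frobenius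
formula `p_μ · a_δ = ∑_λ χ^λ(μ) a_{λ+δ}`, i.e. as the coefficient of the dominant
monomial `x^{λ+δ}` in `p₃ · p₁^{n−3} · a_δ`. -/
def chiThree (lam : YoungDiagram) : ℚ :=
  coeff (domExp lam.card lam)
    (powerSum lam.card 3 * (powerSum lam.card 1) ^ (lam.card - 3) *
      vandermonde lam.card)

/-- The dimension of the irreducible representation `ρ^λ`: the coefficient of `x^{λ+δ}` in
`p₁^n · a_δ`. -/
def dimRep (lam : YoungDiagram) : ℚ :=
  coeff (domExp lam.card lam)
    ((powerSum lam.card 1) ^ lam.card * vandermonde lam.card)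

/-- The normalized character `Σ₃^λ = n(n−1)(n−2)·χ^λ((1,2,3))/dim ρ^λ` (the cycle `(1,2,3)`
regarded as an element of `S(n)` with `n−3` extra fixed points), equal to `0` when
`n = |λ| < 3`. -/
def SigmaThree (lam : YoungDiagram) : ℚ :=
  if 3 ≤ lam.card then
    (lam.card : ℚ) * ((lam.card : ℚ) - 1) * ((lam.card : ℚ) - 2) *
      chiThree lam / dimRep lam
  else 0

section ShiftWeight

variable {ι : Type*} [DecidableEq ι]

/-- The weight `∏_{j ∈ s, j ≠ k} (1 − c / (v k − v j))` of the node `v k`. -/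
def shiftWeight (c : ℚ) (v : ι → ℚ) (s : Finset ι) (k : ι) : ℚ :=
  ∏ j ∈ s.erase k, (1 - c / (v k - v j))

/-- The `r`-th moment of the nodes `v k`, `k ∈ s`, with respect to `shiftWeight`. -/
def shiftMoment (c : ℚ) (v : ι → ℚ) (s : Finset ι) (r : ℕ) : ℚ :=
  ∑ k ∈ s, v k ^ r * shiftWeight c v s k

lemma shiftWeight_insert_of_mem (c : ℚ) (v : ι → ℚ) {s : Finset ι} {a k : ι} (ha : a ∉ s)
    (hk : k ∈ s) :
    shiftWeight c v (insert a s) k = (1 - c / (v k - v a)) * shiftWeight c v s k := by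
  have hak : a ≠ k := fun h => ha (h ▸ hk)
  rw [shiftWeight, Finset.erase_insert_of_ne hak,
    Finset.prod_insert (fun h => ha (Finset.mem_of_mem_erase h)), shiftWeight]

lemma shiftWeight_insert_self (c : ℚ) (v : ι → ℚ) {s : Finset ι} {a : ι} (ha : a ∉ s) :
    shiftWeight c v (insert a s) a = ∏ j ∈ s, (1 - c / (v a - v j)) := by
  rw [shiftWeight, Finset.erase_insert ha]

/-- Partial fraction expansion of `∏ (1 − c / (z − v j))`. -/
lemma prod_one_sub_div (c : ℚ) {v : ι → ℚ} (hv : Function.Injective v) (s : Finset ι) :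
    ∀ z : ℚ, (∀ j ∈ s, z ≠ v j) →
      ∏ j ∈ s, (1 - c / (z - v j)) = 1 - c * ∑ k ∈ s, shiftWeight c v s k / (z - v k) := by
  induction s using Finset.induction_on with
  | empty => simp
  | insert a s ha ih =>
    intro z hz
    have hza : z - v a ≠ 0 := sub_ne_zero.2 (hz a (Finset.mem_insert_self a s))
    have hzs : ∀ j ∈ s, z ≠ v j := fun j hj => hz j (Finset.mem_insert_of_mem hj)
    have has : ∀ j ∈ s, v a ≠ v j := fun j hj h => ha (hv h ▸ hj)
    rw [Finset.prod_insert ha, Finset.sum_insert ha, shiftWeight_insert_self c v ha,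
      ih z hzs, ih (v a) has]
    have key : ∑ k ∈ s, shiftWeight c v (insert a s) k / (z - v k) =
        ∑ k ∈ s, shiftWeight c v s k / (z - v k)
          - c / (z - v a) * ∑ k ∈ s, shiftWeight c v s k / (z - v k)
          + c / (z - v a) * ∑ k ∈ s, shiftWeight c v s k / (v a - v k) := by
      rw [Finset.mul_sum, Finset.mul_sum, ← Finset.sum_sub_distrib, ← Finset.sum_add_distrib]
      refine Finset.sum_congr rfl fun k hk => ?_
      have h1 : z - v k ≠ 0 := sub_ne_zero.2 (hzs k hk)
      have h2 : v a - v k ≠ 0 := sub_ne_zero.2 (has k hk)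
      have h3 : v k - v a ≠ 0 := sub_ne_zero.2 (has k hk).symm
      rw [shiftWeight_insert_of_mem c v ha hk]
      have e : 1 / (v a - v k) = -(1 / (v k - v a)) := by
        rw [← neg_sub (v k), div_neg]
      rw [div_eq_mul_one_div (shiftWeight c v s k) (v a - v k), e]
      field_simp
      ring
    rw [key]
    field_simp
    ring

lemma shiftMoment_insert (c : ℚ) {v : ι → ℚ} (hv : Function.Injective v) {s : Finset ι} {a : ι}
    (ha : a ∉ s) (r : ℕ) :
    shiftMoment c v (insert a s) r = shiftMoment c v s r + v a ^ r -
      c * ∑ i ∈ Finset.range r, shiftMoment c v s i * v a ^ (r - 1 - i) := by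
  have has : ∀ j ∈ s, v a ≠ v j := fun j hj h => ha (hv h ▸ hj)
  have key : ∑ i ∈ Finset.range r, shiftMoment c v s i * v a ^ (r - 1 - i) =
      ∑ k ∈ s, shiftWeight c v s k * ((v k ^ r - v a ^ r) / (v k - v a)) := by
    simp only [shiftMoment, Finset.sum_mul]
    rw [Finset.sum_comm]
    refine Finset.sum_congr rfl fun k hk => ?_
    rw [← geom_sum₂_mul, mul_div_cancel_right₀ _ (sub_ne_zero.2 (has k hk).symm), Finset.mul_sum]
    exact Finset.sum_congr rfl fun i _ => by ring
  rw [key, shiftMoment, Finset.sum_insert ha, shiftWeight_insert_self c v ha,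
    prod_one_sub_div c hv s _ has, shiftMoment, mul_sub, mul_one, Finset.mul_sum, Finset.mul_sum,
    Finset.mul_sum, sub_add_eq_add_sub, add_sub_assoc, ← Finset.sum_sub_distrib, add_comm,
    add_sub_right_comm, ← Finset.sum_sub_distrib]
  congr 1
  refine Finset.sum_congr rfl fun k hk => ?_
  rw [shiftWeight_insert_of_mem c v ha hk]
  have h2 : v a - v k ≠ 0 := sub_ne_zero.2 (has k hk)
  have h3 : v k - v a ≠ 0 := sub_ne_zero.2 (has k hk).symm
  have e : 1 / (v k - v a) = -(1 / (v a - v k)) := by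
    rw [← neg_sub (v a), div_neg]
  rw [div_eq_mul_one_div c (v k - v a), div_eq_mul_one_div _ (v k - v a), e]
  field_simp
  ring

lemma shiftMoment_three_eq {v : ι → ℚ} (hv : Function.Injective v) (s : Finset ι) :
    shiftMoment 3 v s 0 = s.card ∧
    shiftMoment 3 v s 1 = ∑ k ∈ s, v k - 3 * (s.card * (s.card - 1) / 2) ∧
    shiftMoment 3 v s 2 = ∑ k ∈ s, v k ^ 2 - 3 * (s.card - 1) * ∑ k ∈ s, v k +
      9 * (s.card * (s.card - 1) * (s.card - 2) / 6) ∧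
    shiftMoment 3 v s 3 = ∑ k ∈ s, v k ^ 3 - 3 * (s.card - 1) * ∑ k ∈ s, v k ^ 2 -
      3 * (((∑ k ∈ s, v k) ^ 2 - ∑ k ∈ s, v k ^ 2) / 2) +
      9 * ((s.card - 1) * (s.card - 2) / 2) * ∑ k ∈ s, v k -
      27 * (s.card * (s.card - 1) * (s.card - 2) * (s.card - 3) / 24) := by
  induction s using Finset.induction_on with
  | empty => simp [shiftMoment]
  | insert a s ha ih =>
    obtain ⟨h0, h1, h2, h3⟩ := ih
    simp only [shiftMoment_insert 3 hv ha, Finset.sum_insert ha, Finset.card_insert_of_notMem ha,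
      Finset.sum_range_succ, Finset.sum_range_zero, h0, h1, h2, h3]
    push_cast
    refine ⟨?_, ?_, ?_, ?_⟩ <;> ring

end ShiftWeight

lemma det_vandermonde_update {n : ℕ} {v : Fin n → ℚ} (hv : Function.Injective v) (k : Fin n)
    (x : ℚ) :
    (Matrix.vandermonde (Function.update v k x)).det =
      (Matrix.vandermonde v).det * ∏ j ∈ univ.erase k, ((x - v j) / (v k - v j)) := by
  have hne : ∀ {i j}, i ≠ j → v i - v j ≠ 0 := fun h => sub_ne_zero.2 (hv.ne h)
  have hlt : (univ.erase k).filter (fun j => ¬ j < k) = Ioi k := by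
    ext j; simp; grind
  have hterm : ∀ i j : Fin n, i < j → Function.update v k x j - Function.update v k x i =
      (v j - v i) * ((if i = k then (x - v j) / (v k - v j) else 1) *
        (if j = k then (x - v i) / (v k - v i) else 1)) := by
    intro i j hij
    have := hne hij.ne
    have := hne hij.ne'
    by_cases hi : i = k
    · subst hi
      rw [Function.update_self, Function.update_of_ne hij.ne', if_pos rfl, if_neg hij.ne']
      field_simp
      ring
    · by_cases hj : j = k
      · subst hj
        rw [Function.update_self, Function.update_of_ne hij.ne, if_pos rfl, if_neg hij.ne]
        field_simp
      · simp [Function.update_of_ne, hi, hj]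
  rw [Matrix.det_vandermonde, Matrix.det_vandermonde,
    Finset.prod_congr rfl fun i _ => Finset.prod_congr rfl fun j hj => hterm i j (mem_Ioi.1 hj)]
  simp only [Finset.prod_mul_distrib]
  congr 1
  rw [← Finset.prod_filter_mul_prod_filter_not (univ.erase k) (fun j => j < k), hlt, mul_comm]
  congr 1
  · have : ∀ i : Fin n, (∏ j ∈ Ioi i, if j = k then (x - v i) / (v k - v i) else 1) =
        if i < k then (x - v i) / (v k - v i) else 1 := by
      intro i
      rw [Finset.prod_ite_eq']
      simp
    rw [Finset.prod_congr rfl fun i _ => this i, Finset.prod_ite, Finset.prod_const_one, mul_one]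
    refine Finset.prod_congr ?_ fun _ _ => rfl
    ext j; simp; exact fun h => h.ne
  · rw [Finset.prod_eq_single k] <;> simp +contextual

/-- The total degree of the alternant `vandermonde n`. -/
def staircaseSize (n : ℕ) : ℕ := ∑ i : Fin n, (n - 1 - (i : ℕ))

lemma prod_X_pow_eq_monomial_equivFunOnFinite {n : ℕ} (f : Fin n → ℕ) :
    ∏ i, (X i : MvPolynomial (Fin n) ℚ) ^ f i = monomial (Finsupp.equivFunOnFinite.symm f) 1 := by
  rw [monomial_eq, Finsupp.prod_fintype _ _ (by simp)]
  simp

lemma coeff_powerSum_one_pow {n N : ℕ} (d : Fin n →₀ ℕ) (hd : ∑ i, d i = N) :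
    coeff d (powerSum n 1 ^ N) * ∏ i, ((d i).factorial : ℚ) = N.factorial := by
  have h : d.sum (fun _ m => m) = N := by rw [Finsupp.sum_fintype _ _ (by simp), hd]
  simp only [powerSum, pow_one]
  rw [coeff_sum_X_pow_of_fintype, if_pos h,
    Finsupp.multinomial_eq_of_support_subset (Finset.subset_univ _), mul_comm]
  have := Nat.multinomial_spec univ d
  rw [hd] at this
  exact_mod_cast this

lemma coeff_powerSum_one_pow_mul_monomial {n N : ℕ} (m d : Fin n →₀ ℕ)
    (hm : ∑ i, m i = N + ∑ i, d i) :
    coeff m (powerSum n 1 ^ N * monomial d 1) * ∏ i, ((m i).factorial : ℚ) =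
      N.factorial * ∏ i, ((m i).descFactorial (d i) : ℚ) := by
  rw [coeff_mul_monomial']
  split_ifs with h
  · have hsum : ∑ i, (m - d) i = N := by
      have : ∑ i, (m - d) i + ∑ i, d i = ∑ i, m i := by
        rw [← Finset.sum_add_distrib]
        exact Finset.sum_congr rfl fun i _ => Nat.sub_add_cancel (h i)
      omega
    rw [← coeff_powerSum_one_pow (m - d) hsum, mul_one, mul_assoc, ← Finset.prod_mul_distrib]
    congr 1
    refine Finset.prod_congr rfl fun i _ => ?_
    rw [← Nat.factorial_mul_descFactorial (h i)]
    push_cast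
    rfl
  · obtain ⟨i, hi⟩ : ∃ i, m i < d i := by
      by_contra! hc
      exact h hc
    rw [Finset.prod_eq_zero (i := i) (f := fun i => ((m i).descFactorial (d i) : ℚ))
      (Finset.mem_univ i) (by rw [Nat.descFactorial_of_lt hi, Nat.cast_zero])]
    simp

lemma sum_sign_smul_prod_descFactorial {n : ℕ} (m : Fin n → ℕ) :
    ∑ σ : Perm (Fin n), ((Perm.sign σ : ℤ) : ℚ) *
        ∏ i, ((m i).descFactorial (n - 1 - (σ i : ℕ)) : ℚ) =
      ((Perm.sign (Fin.revPerm : Perm (Fin n)) : ℤ) : ℚ) *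
        (Matrix.vandermonde fun i => (m i : ℚ)).det := by
  rw [Matrix.det_eval_matrixOfPolynomials_eq_det_vandermonde _
    (fun j : Fin n => descPochhammer ℚ j) (fun j => descPochhammer_natDegree ℚ j)
    (fun j => monic_descPochhammer ℚ j), ← Matrix.det_permute', ← Matrix.det_transpose,
    Matrix.det_apply']
  refine Finset.sum_congr rfl fun σ _ => ?_
  congr 1
  refine Finset.prod_congr rfl fun i _ => ?_
  simp only [Matrix.transpose_apply, Matrix.submatrix_apply, Matrix.of_apply, id,
    descPochhammer_eval_eq_descFactorial, Fin.revPerm_apply, Fin.val_rev]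
  congr 2
  omega

lemma coeff_powerSum_one_pow_mul_vandermonde {n N : ℕ} (m : Fin n →₀ ℕ)
    (hm : ∑ i, m i = N + staircaseSize n) :
    coeff m (powerSum n 1 ^ N * vandermonde n) * ∏ i, ((m i).factorial : ℚ) =
      N.factorial * (((Perm.sign (Fin.revPerm : Perm (Fin n)) : ℤ) : ℚ) *
        (Matrix.vandermonde fun i => (m i : ℚ)).det) := by
  rw [← sum_sign_smul_prod_descFactorial, vandermonde, Finset.mul_sum, coeff_sum, Finset.sum_mul,
    Finset.mul_sum]
  refine Finset.sum_congr rfl fun σ _ => ?_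
  have hd : ∑ i, m i = N + ∑ i, (Finsupp.equivFunOnFinite.symm
      fun i => n - 1 - (σ i : ℕ) : Fin n →₀ ℕ) i := by
    rw [hm, staircaseSize, ← Equiv.sum_comp σ]
    rfl
  rw [prod_X_pow_eq_monomial_equivFunOnFinite, mul_smul_comm, coeff_smul, smul_mul_assoc,
    coeff_powerSum_one_pow_mul_monomial m _ hd, zsmul_eq_mul]
  simp only [Finsupp.equivFunOnFinite_symm_apply_apply]
  ring

lemma coeff_powerSum_three_mul {n N : ℕ} (m : Fin n →₀ ℕ)
    (hm : ∑ i, m i = N + 3 + staircaseSize n) (hinj : Function.Injective m) :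
    coeff m (powerSum n 3 * powerSum n 1 ^ N * vandermonde n) * ∏ i, ((m i).factorial : ℚ) =
      N.factorial * (((Perm.sign (Fin.revPerm : Perm (Fin n)) : ℤ) : ℚ) *
        (Matrix.vandermonde fun i => (m i : ℚ)).det) *
        ∑ k, ((m k).descFactorial 3 : ℚ) * shiftWeight 3 (fun i => (m i : ℚ)) univ k := by
  have hv : Function.Injective fun i => (m i : ℚ) := Nat.cast_injective.comp hinj
  rw [mul_assoc, powerSum, Finset.sum_mul, coeff_sum, Finset.sum_mul, Finset.mul_sum]
  refine Finset.sum_congr rfl fun k _ => ?_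
  rw [X_pow_eq_monomial, coeff_monomial_mul']
  split_ifs with h
  · have hk : 3 ≤ m k := by simpa using h k
    have hval : ∀ i, (m - Finsupp.single k 3 : Fin n →₀ ℕ) i = Function.update m k (m k - 3) i := by
      intro i
      rcases eq_or_ne i k with rfl | hi
      · simp
      · simp [hi]
    have hsum : ∑ i, (m - Finsupp.single k 3 : Fin n →₀ ℕ) i = N + staircaseSize n := by
      have : ∑ i, (m - Finsupp.single k 3 : Fin n →₀ ℕ) i + ∑ i, Finsupp.single k 3 i = ∑ i, m i := by
        rw [← Finset.sum_add_distrib]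
        exact Finset.sum_congr rfl fun i _ => Nat.sub_add_cancel (h i)
      have h3 : ∑ i, Finsupp.single k 3 i = 3 := by simp [Finsupp.single_apply]
      omega
    have hfac : ∏ i, ((m i).factorial : ℚ) =
        (∏ i, (((m - Finsupp.single k 3 : Fin n →₀ ℕ) i).factorial : ℚ)) * (m k).descFactorial 3 := by
      rw [← Finset.mul_prod_erase univ _ (Finset.mem_univ k),
        ← Finset.mul_prod_erase univ
          (fun i => (((m - Finsupp.single k 3 : Fin n →₀ ℕ) i).factorial : ℚ))
          (Finset.mem_univ k),
        ← Nat.factorial_mul_descFactorial hk, hval k, Function.update_self]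
      have : ∏ i ∈ univ.erase k, (((m - Finsupp.single k 3 : Fin n →₀ ℕ) i).factorial : ℚ) =
          ∏ i ∈ univ.erase k, ((m i).factorial : ℚ) :=
        Finset.prod_congr rfl fun i hi => by
          rw [hval i, Function.update_of_ne (Finset.ne_of_mem_erase hi)]
      rw [this]
      push_cast
      ring
    have hcast : (fun i => (((m - Finsupp.single k 3 : Fin n →₀ ℕ) i : ℕ) : ℚ)) =
        Function.update (fun i => (m i : ℚ)) k ((m k : ℚ) - 3) := by
      funext i
      rw [hval i]
      rcases eq_or_ne i k with rfl | hi
      · simp [Nat.cast_sub hk]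
      · simp [hi]
    have hw : ∏ j ∈ univ.erase k, (((m k : ℚ) - 3 - m j) / ((m k : ℚ) - m j)) =
        shiftWeight 3 (fun i => (m i : ℚ)) univ k := by
      refine Finset.prod_congr rfl fun j hj => ?_
      have : (m k : ℚ) - m j ≠ 0 := sub_ne_zero.2 (hv.ne (Finset.ne_of_mem_erase hj).symm)
      field_simp
      ring
    rw [hfac, one_mul, ← mul_assoc, coeff_powerSum_one_pow_mul_vandermonde _ hsum, hcast,
      det_vandermonde_update hv, hw]
    ring
  · have hk : m k < 3 := by
      by_contra! hc
      exact h (Finsupp.single_le_iff.2 hc)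
    rw [Nat.descFactorial_of_lt hk]
    simp

section Young

variable (lam : YoungDiagram)

lemma rowLen_eq_zero_of_card_le {i : ℕ} (hi : lam.card ≤ i) : lam.rowLen i = 0 := by
  by_contra h
  have hmem : (i, 0) ∈ lam := YoungDiagram.mem_iff_lt_rowLen.2 (Nat.pos_of_ne_zero h)
  have hsub : (Finset.range (i + 1)).image (fun r => (r, 0)) ⊆ lam.cells := by
    intro p hp
    obtain ⟨r, hr, rfl⟩ := Finset.mem_image.1 hp
    exact lam.up_left_mem (Nat.lt_succ_iff.1 (Finset.mem_range.1 hr)) le_rfl hmem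
  have := Finset.card_le_card hsub
  rw [Finset.card_image_of_injective _ (fun a b h => (Prod.mk.inj h).1), Finset.card_range] at this
  change i + 1 ≤ lam.card at this
  omega

lemma sum_cells {M : Type*} [AddCommMonoid M] (g : ℕ × ℕ → M) :
    ∑ b ∈ lam.cells, g b = ∑ i : Fin lam.card, ∑ j ∈ Finset.range (lam.rowLen i), g (i, j) := by
  rw [Fin.sum_univ_eq_sum_range (fun i => ∑ j ∈ Finset.range (lam.rowLen i), g (i, j))]
  refine Finset.sum_finset_product _ _ _ fun p => ?_
  rw [YoungDiagram.mem_cells, ← Prod.mk.eta (p := p), YoungDiagram.mem_iff_lt_rowLen,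
    Finset.mem_range, Finset.mem_range]
  refine ⟨fun h => ⟨?_, h⟩, fun h => h.2⟩
  by_contra! hc
  simp [rowLen_eq_zero_of_card_le lam hc] at h

lemma sum_rowLen : ∑ i : Fin lam.card, lam.rowLen i = lam.card := by
  have := sum_cells lam (fun _ => 1)
  simpa using this.symm

lemma sum_domExp : ∑ i, domExp lam.card lam i = lam.card + staircaseSize lam.card := by
  simp only [domExp, Finsupp.equivFunOnFinite_symm_apply_apply, Finset.sum_add_distrib,
    sum_rowLen, staircaseSize]

lemma domExp_injective : Function.Injective (domExp lam.card lam) := by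
  refine StrictAnti.injective fun i j hij => ?_
  have h := lam.rowLen_anti i j hij.le
  simp only [domExp, Finsupp.equivFunOnFinite_symm_apply_apply]
  have := j.2
  have : (i : ℕ) < j := hij
  omega

lemma cast_domExp (i : Fin lam.card) :
    (domExp lam.card lam i : ℚ) = lam.rowLen i - i + (lam.card - 1) := by
  have := i.2
  simp only [domExp, Finsupp.equivFunOnFinite_symm_apply_apply, Nat.cast_add]
  rw [Nat.sub_sub, Nat.cast_sub (by omega)]
  push_cast
  ring

/-- The sum of the squared contents of the boxes. -/
def contentSq : ℚ := ∑ b ∈ lam.cells, ((b.2 : ℚ) - b.1) ^ 2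

lemma sum_range_content_sq (l : ℕ) (i : ℚ) :
    ∑ j ∈ Finset.range l, ((j : ℚ) - i) ^ 2 =
      ((l - i) ^ 3 / 3 - (l - i) ^ 2 / 2 + (l - i) / 6) - (-i ^ 3 / 3 - i ^ 2 / 2 - i / 6) := by
  induction l with
  | zero => simp; ring
  | succ l ih =>
    rw [Finset.sum_range_succ, ih]
    push_cast
    ring

lemma sum_fin_pow (n : ℕ) :
    ∑ i : Fin n, (i : ℚ) = n * (n - 1) / 2 ∧
    ∑ i : Fin n, (i : ℚ) ^ 2 = n * (n - 1) * (2 * n - 1) / 6 ∧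
    ∑ i : Fin n, (i : ℚ) ^ 3 = (n * (n - 1) / 2) ^ 2 := by
  induction n with
  | zero => simp
  | succ n ih =>
    obtain ⟨h1, h2, h3⟩ := ih
    simp only [Fin.sum_univ_castSucc, Fin.val_castSucc, Fin.val_last, h1, h2, h3]
    push_cast
    refine ⟨?_, ?_, ?_⟩ <;> ring

lemma sum_descFactorial_mul_shiftWeight :
    ∑ k, ((domExp lam.card lam k).descFactorial 3 : ℚ) *
        shiftWeight 3 (fun i => (domExp lam.card lam i : ℚ)) univ k =
      3 * contentSq lam - 3 * (lam.card * (lam.card - 1) / 2) := by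
  have hv : Function.Injective fun i => (domExp lam.card lam i : ℚ) :=
    Nat.cast_injective.comp (domExp_injective lam)
  obtain ⟨-, h1, h2, h3⟩ := shiftMoment_three_eq hv univ
  have hdesc : ∀ a : ℕ, (a.descFactorial 3 : ℚ) = (a : ℚ) ^ 3 - 3 * a ^ 2 + 2 * a ^ 1 := by
    intro a
    rw [← descPochhammer_eval_eq_descFactorial ℚ]
    simp [descPochhammer_succ_eval]
    ring
  have hL : ∑ k, ((domExp lam.card lam k).descFactorial 3 : ℚ) *
        shiftWeight 3 (fun i => (domExp lam.card lam i : ℚ)) univ k =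
      shiftMoment 3 (fun i => (domExp lam.card lam i : ℚ)) univ 3 -
      3 * shiftMoment 3 (fun i => (domExp lam.card lam i : ℚ)) univ 2 +
      2 * shiftMoment 3 (fun i => (domExp lam.card lam i : ℚ)) univ 1 := by
    simp only [shiftMoment, Finset.mul_sum, ← Finset.sum_sub_distrib, ← Finset.sum_add_distrib]
    refine Finset.sum_congr rfl fun k _ => ?_
    rw [hdesc]
    ring
  obtain ⟨s1, s2, s3⟩ := sum_fin_pow lam.card
  have hl : ∑ i : Fin lam.card, ((lam.rowLen i : ℚ) - i) =
      lam.card - lam.card * (lam.card - 1) / 2 := by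
    rw [Finset.sum_sub_distrib, s1, ← Nat.cast_sum, sum_rowLen]
  have hc : contentSq lam = (∑ i : Fin lam.card, ((lam.rowLen i : ℚ) - i) ^ 3) / 3 -
      (∑ i : Fin lam.card, ((lam.rowLen i : ℚ) - i) ^ 2) / 2 +
      (∑ i : Fin lam.card, ((lam.rowLen i : ℚ) - i)) / 6 -
      (-(∑ i : Fin lam.card, (i : ℚ) ^ 3) / 3 - (∑ i : Fin lam.card, (i : ℚ) ^ 2) / 2 -
        (∑ i : Fin lam.card, (i : ℚ)) / 6) := by
    rw [contentSq, sum_cells]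
    simp only [sum_range_content_sq, Finset.sum_sub_distrib, Finset.sum_add_distrib,
      ← Finset.sum_div, ← Finset.sum_neg_distrib]
  have p1 : ∑ i, (domExp lam.card lam i : ℚ) =
      ∑ i : Fin lam.card, ((lam.rowLen i : ℚ) - i) + lam.card * (lam.card - 1) := by
    simp only [cast_domExp, Finset.sum_add_distrib]
    simp
    ring
  have p2 : ∑ i, (domExp lam.card lam i : ℚ) ^ 2 =
      ∑ i : Fin lam.card, ((lam.rowLen i : ℚ) - i) ^ 2 +
      2 * (lam.card - 1) * ∑ i : Fin lam.card, ((lam.rowLen i : ℚ) - i) +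
      lam.card * (lam.card - 1) ^ 2 := by
    have hconst : (lam.card : ℚ) * (lam.card - 1) ^ 2 =
        ∑ _i : Fin lam.card, ((lam.card : ℚ) - 1) ^ 2 := by simp
    rw [hconst]
    simp only [Finset.mul_sum, ← Finset.sum_add_distrib]
    refine Finset.sum_congr rfl fun i _ => ?_
    rw [cast_domExp]
    ring
  have p3 : ∑ i, (domExp lam.card lam i : ℚ) ^ 3 =
      ∑ i : Fin lam.card, ((lam.rowLen i : ℚ) - i) ^ 3 +
      3 * (lam.card - 1) * ∑ i : Fin lam.card, ((lam.rowLen i : ℚ) - i) ^ 2 +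
      3 * (lam.card - 1) ^ 2 * ∑ i : Fin lam.card, ((lam.rowLen i : ℚ) - i) +
      lam.card * (lam.card - 1) ^ 3 := by
    have hconst : (lam.card : ℚ) * (lam.card - 1) ^ 3 =
        ∑ _i : Fin lam.card, ((lam.card : ℚ) - 1) ^ 3 := by simp
    rw [hconst]
    simp only [Finset.mul_sum, ← Finset.sum_add_distrib]
    refine Finset.sum_congr rfl fun i _ => ?_
    rw [cast_domExp]
    ring
  rw [hL, h1, h2, h3, p1, p2, p3, hc, hl, s1, s2, s3, Finset.card_univ, Fintype.card_fin]
  ring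

lemma sigmaThree_eq (h : 3 ≤ lam.card) :
    SigmaThree lam = 3 * contentSq lam - 3 * (lam.card * (lam.card - 1) / 2) := by
  have hinj := domExp_injective lam
  have hdim := coeff_powerSum_one_pow_mul_vandermonde _ (sum_domExp lam)
  have hchi := coeff_powerSum_three_mul (N := lam.card - 3) _
    (by rw [sum_domExp]; omega) hinj
  rw [sum_descFactorial_mul_shiftWeight] at hchi
  have hfac : (lam.card.factorial : ℚ) =
      lam.card * (lam.card - 1) * (lam.card - 2) * (lam.card - 3).factorial := by
    obtain ⟨m, hm⟩ := Nat.exists_eq_add_of_le' h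
    rw [hm, Nat.add_sub_cancel]
    simp only [Nat.factorial_succ]
    push_cast
    ring
  have hV : (Matrix.vandermonde fun i => (domExp lam.card lam i : ℚ)).det ≠ 0 :=
    Matrix.det_vandermonde_ne_zero_iff.2 (Nat.cast_injective.comp hinj)
  have hS : (((Perm.sign (Fin.revPerm : Perm (Fin lam.card)) : ℤ)) : ℚ) ≠ 0 :=
    Int.cast_ne_zero.2 (Units.ne_zero _)
  have hP : ∏ i, ((domExp lam.card lam i).factorial : ℚ) ≠ 0 :=
    Finset.prod_ne_zero_iff.2 fun i _ => Nat.cast_ne_zero.2 (Nat.factorial_ne_zero _)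
  have hN : (lam.card.factorial : ℚ) ≠ 0 := Nat.cast_ne_zero.2 (Nat.factorial_ne_zero _)
  have hd0 : dimRep lam ≠ 0 := by
    intro h0
    change dimRep lam * _ = _ at hdim
    rw [h0, zero_mul] at hdim
    exact mul_ne_zero hN (mul_ne_zero hS hV) hdim.symm
  rw [SigmaThree, if_pos h, div_eq_iff hd0]
  change dimRep lam * _ = _ at hdim
  change chiThree lam * _ = _ at hchi
  refine mul_right_cancel₀ hP ?_
  rw [mul_assoc, hchi, mul_assoc _ (dimRep lam), hdim, hfac]
  ring

lemma contentSq_of_card_lt_three (h : lam.card < 3) :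
    3 * contentSq lam - 3 * (lam.card * (lam.card - 1) / 2) = 0 := by
  have hc : contentSq lam =
      ∑ i : Fin lam.card, ∑ j ∈ Finset.range (lam.rowLen i), ((j : ℚ) - (i : ℕ)) ^ 2 :=
    sum_cells lam _
  have hr := sum_rowLen lam
  have hanti := lam.rowLen_anti 0 1 zero_le_one
  rw [hc]
  clear hc
  generalize lam.card = n at *
  interval_cases n
  · simp
  · simp only [Fin.sum_univ_one, Fin.val_zero] at hr ⊢
    simp [hr]
  · simp only [Fin.sum_univ_two, Fin.val_zero, Fin.val_one] at hr ⊢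
    obtain ⟨h0, h1⟩ | ⟨h0, h1⟩ : (lam.rowLen 0 = 2 ∧ lam.rowLen 1 = 0) ∨
        (lam.rowLen 0 = 1 ∧ lam.rowLen 1 = 1) := by omega
    all_goals
      rw [h0, h1]
      norm_num [Finset.sum_range_succ]

lemma sfun_one : Sfun lam 1 = 0 := by
  rw [Sfun, Finset.sum_eq_zero fun _ _ => by ring, mul_zero]

lemma sfun_two : Sfun lam 2 = lam.card := by
  rw [Sfun, Finset.sum_congr rfl fun b _ => show _ = (2 : ℚ) by ring]
  simp [YoungDiagram.card]
  ring

lemma sfun_four : Sfun lam 4 = 3 * contentSq lam + lam.card / 2 := by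
  rw [Sfun, Finset.sum_congr rfl fun b _ =>
    show _ = 12 * ((b.2 : ℚ) - b.1) ^ 2 + 2 by ring, Finset.sum_add_distrib, ← Finset.mul_sum,
    ← contentSq]
  simp [YoungDiagram.card]
  ring

lemma rfun_two : Rfun lam 2 = lam.card := by
  have e1 : (Finset.Nat.antidiagonalTuple 1 2).filter (fun c => ∀ i, 1 ≤ c i) = {![2]} := by
    decide
  have e2 : (Finset.Nat.antidiagonalTuple 2 2).filter (fun c => ∀ i, 1 ≤ c i) = {![1, 1]} := by
    decide
  rw [Rfun, show Finset.Icc 1 2 = {1, 2} from rfl, Finset.sum_pair (by decide), e1, e2]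
  simp [sfun_one, sfun_two]

lemma rfun_four : Rfun lam 4 = 3 * contentSq lam + lam.card / 2 - 3 / 2 * lam.card ^ 2 := by
  have e1 : (Finset.Nat.antidiagonalTuple 1 4).filter (fun c => ∀ i, 1 ≤ c i) = {![4]} := by
    decide
  have e2 : (Finset.Nat.antidiagonalTuple 2 4).filter (fun c => ∀ i, 1 ≤ c i) =
      {![1, 3], ![2, 2], ![3, 1]} := by
    decide
  have e3 : (Finset.Nat.antidiagonalTuple 3 4).filter (fun c => ∀ i, 1 ≤ c i) =
      {![1, 1, 2], ![1, 2, 1], ![2, 1, 1]} := by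
    decide
  have e4 : (Finset.Nat.antidiagonalTuple 4 4).filter (fun c => ∀ i, 1 ≤ c i) =
      {![1, 1, 1, 1]} := by
    decide
  rw [Rfun, show Finset.Icc 1 4 = {1, 2, 3, 4} from rfl, Finset.sum_insert (by decide),
    Finset.sum_insert (by decide), Finset.sum_pair (by decide), e1, e2, e3, e4]
  simp [Fin.prod_univ_succ, sfun_one, sfun_two, sfun_four]
  ring

end Young

/-- The Kerov polynomial identity `Σ₃ = R₄ + R₂`: for every Young diagram `λ`, the
normalized character of the symmetric group on the 3-cycle equals `R₄^λ + R₂^λ`, where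
`R_k^λ` are the free cumulants of the Kerov transition measure of `λ`. -/
theorem kerov_sigma_three (lam : YoungDiagram) :
    SigmaThree lam = Rfun lam 4 + Rfun lam 2 := by
  rw [rfun_two, rfun_four]
  have key : SigmaThree lam = 3 * contentSq lam - 3 * (lam.card * (lam.card - 1) / 2) := by
    by_cases h : 3 ≤ lam.card
    · exact sigmaThree_eq lam h
    · rw [SigmaThree, if_neg h, contentSq_of_card_lt_three lam (not_le.1 h)]
  rw [key]
  ring

end
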